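/- Consider the H-model with parameter p and suppose θ = θ_NE(1−p) > 0. Then for each N > 0 there exists M > N such that for some A ∈ [N,M], the probability that the event B^O(A) occurs with the whole path contained in Λ_M \ Λ_N is strictly greater than (θ(1−p)/2)⁴. -/

import Mathlib

open MeasureTheory ENNReal

namespace RandomOrientation

/-- One step of the base-`(p, 1-p)` expansion map on `[0,1)`. -/
noncomputable def expand (p x : ℝ) : ℝ := if x < p then x / p else (x - p) / (1 - p)

/-- The `n`-th digit of the Bernoulli(`p`) expansion of `x`: for `x` uniformly
distributed on `[0,1)` the digits are i.i.d. `{true, false}`-valued with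
`P(true) = p`. -/
noncomputable def bernDigit (p : ℝ) (n : ℕ) (x : ℝ) : Bool :=
  decide ((expand p)^[n] x < p)

/-- The product over the countable index set `I` of Bernoulli(`p`) measures on
`Bool` (`P(true) = p`), realized as the joint distribution of the digits of the
Bernoulli(`p`) expansion of a uniform random point of `[0,1)`. -/
noncomputable def bernoulliProduct (I : Type*) [Encodable I] (p : ℝ) :
    Measure (I → Bool) :=
  Measure.map (fun x i => bernDigit p (Encodable.encode i) x)
    (volume.restrict (Set.Ico (0 : ℝ) 1))

/-- Edges of `ℤ²`: `(v, false)` is the horizontal edge from `v` to `v + (1,0)`,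
`(v, true)` the vertical edge from `v` to `v + (0,1)`. -/
abbrev Edge : Type := (ℤ × ℤ) × Bool

/-- An orientation configuration of the edges of `ℤ²`. -/
abbrev Config : Type := Edge → Bool

def eSrc (e : Edge) : ℤ × ℤ := e.1

def eDst (e : Edge) : ℤ × ℤ := if e.2 then (e.1.1, e.1.2 + 1) else (e.1.1 + 1, e.1.2)

/-- The law of the random orientation with parameter `p`: each edge independently
carries the bit `true` with probability `p`. -/
noncomputable def mu (p : ℝ) : Measure Config := bernoulliProduct Edge p

/-- The directed-edge relation of Grimmett's random-orientation model:
`ω e = true` means the edge `e` is oriented in the positive coordinate direction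
(rightwards resp. upwards), `ω e = false` in the negative one. -/
def gStep (ω : Config) (u v : ℤ × ℤ) : Prop :=
  ∃ e : Edge, (eSrc e = u ∧ eDst e = v ∧ ω e = true) ∨ (eSrc e = v ∧ eDst e = u ∧ ω e = false)

/-- Squared euclidean norm on `ℤ²`. -/
def normSq (v : ℤ × ℤ) : ℤ := v.1 ^ 2 + v.2 ^ 2

/-- The directed-edge relation of the H-model: `ω e = true` means the edge `e` is
oriented away from the origin, i.e. towards its endpoint of larger euclidean norm
(adjacent vertices of `ℤ²` never have equal norms). -/
def hStep (ω : Config) (u v : ℤ × ℤ) : Prop :=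
  ∃ e : Edge, ((eSrc e = u ∧ eDst e = v) ∨ (eSrc e = v ∧ eDst e = u)) ∧
    ω e = decide (normSq u < normSq v)

/-- There is an infinite directed self-avoiding path starting at the origin,
all of whose vertices lie in `S`, for the directed-step relation `R`. -/
def percolates (R : ℤ × ℤ → ℤ × ℤ → Prop) (S : Set (ℤ × ℤ)) : Prop :=
  ∃ γ : ℕ → ℤ × ℤ, γ 0 = (0, 0) ∧ Function.Injective γ ∧
    (∀ n, R (γ n) (γ (n + 1))) ∧ ∀ n, γ n ∈ S

/-- The (closed) North-East quadrant of `ℤ²`. -/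
def NEquad : Set (ℤ × ℤ) := {v | 0 ≤ v.1 ∧ 0 ≤ v.2}

/-- `θ_H(p)`: percolation probability of the H-model with parameter `p`. -/
noncomputable def thetaH (p : ℝ) : ℝ≥0∞ := mu p {ω | percolates (hStep ω) Set.univ}

/-- `θ_NE(p)`: probability of an infinite directed self-avoiding path from the
origin staying in the North-East quadrant, in the random-orientation model. -/
noncomputable def thetaNE (p : ℝ) : ℝ≥0∞ := mu p {ω | percolates (gStep ω) NEquad}

/-- `θ_G(p)`: percolation probability of Grimmett's random-orientation model. -/
noncomputable def thetaG (p : ℝ) : ℝ≥0∞ := mu p {ω | percolates (gStep ω) Set.univ}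

/-- The primal edge `e` is oriented in the positive coordinate direction, for the
H-model configuration `ω` (`ω e = true` means oriented away from the origin). -/
def hPos (ω : Config) (e : Edge) : Prop := ω e = decide (normSq (eSrc e) < normSq (eDst e))

/-- Directed step relation of the dual lattice `ℤ²ᵘ_d`.  The coded dual vertex
`(a, b) : ℤ × ℤ` stands for the point `(a + 1/2, b + 1/2)`.  A dual edge is
oriented in the direction of the *absent* orientation of the primal edge it
crosses, rotated by `π/2`; the dual edge between `(a,b)` and `(a+1,b)` crosses
the primal vertical edge `((a+1, b), true)`, and the dual edge between `(a,b)`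
and `(a,b+1)` crosses the primal horizontal edge `((a, b+1), false)`. -/
def dualStep (ω : Config) (d d' : ℤ × ℤ) : Prop :=
  (d' = (d.1 + 1, d.2) ∧ hPos ω ((d.1 + 1, d.2), true)) ∨
  (d = (d'.1 + 1, d'.2) ∧ ¬hPos ω ((d'.1 + 1, d'.2), true)) ∨
  (d' = (d.1, d.2 + 1) ∧ ¬hPos ω ((d.1, d.2 + 1), false)) ∨
  (d = (d'.1, d'.2 + 1) ∧ hPos ω ((d'.1, d'.2 + 1), false))

/-- The coded dual vertex `d` (i.e. the point `d + (1/2, 1/2)`) lies in the box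
`Λ_m = [-m, m]²`. -/
def inBox (m : ℕ) (d : ℤ × ℤ) : Prop := -(m : ℤ) ≤ d.1 ∧ d.1 < m ∧ -(m : ℤ) ≤ d.2 ∧ d.2 < m

/-- The coded dual vertex lies in the (open) NE quadrant `x > 0, y > 0`. -/
def dualNE (d : ℤ × ℤ) : Prop := 0 ≤ d.1 ∧ 0 ≤ d.2

/-- The coded dual vertex lies in the NW quadrant `x < 0, y > 0`. -/
def dualNW (d : ℤ × ℤ) : Prop := d.1 < 0 ∧ 0 ≤ d.2

/-- The coded dual vertex lies in the SW quadrant `x < 0, y < 0`. -/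
def dualSW (d : ℤ × ℤ) : Prop := d.1 < 0 ∧ d.2 < 0

/-- The coded dual vertex lies in the SE quadrant `x > 0, y < 0`. -/
def dualSE (d : ℤ × ℤ) : Prop := 0 ≤ d.1 ∧ d.2 < 0

/-- `B^O(A)` (with `A = a + 1/2`), restricted to `Λ_M \ Λ_N`: there is a directed
path in the dual lattice `ℤ²ᵘ_d` of the form
`(A, 1/2) → (1/2, B) → (-C, -1/2) → (1/2, -D) → (E, 1/2)` for some
`B, C, D, E > 0`, where each portion between consecutive axis crossings lies in a
single dual quadrant (NE, then NW, then SW, then SE, ending back in NE), and the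
whole path lies in `Λ_M \ Λ_N`. -/
def BOpath (N M a : ℕ) (ω : Config) : Prop :=
  ∃ (γ : ℕ → ℤ × ℤ) (L t₁ t₂ t₃ : ℕ), t₁ < t₂ ∧ t₂ < t₃ ∧ t₃ < L ∧
    γ 0 = ((a : ℤ), 0) ∧ (γ L).2 = 0 ∧ 0 ≤ (γ L).1 ∧
    (∀ i < L, dualStep ω (γ i) (γ (i + 1))) ∧
    (∀ i ≤ L, inBox M (γ i) ∧ ¬inBox N (γ i)) ∧
    (∀ i ≤ t₁, dualNE (γ i)) ∧
    (∀ i, t₁ < i → i ≤ t₂ → dualNW (γ i)) ∧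
    (∀ i, t₂ < i → i ≤ t₃ → dualSW (γ i)) ∧
    (∀ i, t₃ < i → i < L → dualSE (γ i))

/-! ### The product measure -/

open ProbabilityTheory Filter Topology

/-- The Bernoulli(`p`) measure on `Bool`. -/
noncomputable def bern (p : ℝ) : Measure Bool :=
  ENNReal.ofReal p • Measure.dirac true + ENNReal.ofReal (1 - p) • Measure.dirac false

lemma bern_apply (p : ℝ) (t : Set Bool) :
    bern p t = ENNReal.ofReal p * t.indicator 1 true
      + ENNReal.ofReal (1 - p) * t.indicator 1 false := by
  simp [bern]

lemma isProbabilityMeasure_bern {p : ℝ} (hp0 : 0 ≤ p) (hp1 : p ≤ 1) :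
    IsProbabilityMeasure (bern p) := by
  constructor
  rw [bern_apply]
  simp only [Set.mem_univ, Set.indicator_of_mem, Pi.one_apply, mul_one]
  rw [← ENNReal.ofReal_add hp0 (by linarith)]
  simp

lemma measurable_expand (p : ℝ) : Measurable (expand p) := by
  unfold expand
  exact Measurable.ite measurableSet_Iio (by fun_prop) (by fun_prop)

lemma measurable_bernDigit (p : ℝ) (n : ℕ) : Measurable (bernDigit p n) := by
  have h : MeasurableSet {x : ℝ | (expand p)^[n] x < p} :=
    ((measurable_expand p).iterate n) measurableSet_Iio
  refine measurable_to_countable' fun b => ?_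
  cases b
  · convert h.compl using 1
    ext x
    simp [bernDigit]
  · convert h using 1
    ext x
    simp [bernDigit]

lemma volume_expand_low {p : ℝ} (hp0 : 0 ≤ p) (hp1 : p ≤ 1) (B : Set ℝ) :
    volume {x | (x < p ∧ expand p x ∈ B) ∧ x ∈ Set.Ico (0 : ℝ) 1} =
      ENNReal.ofReal p * volume (B ∩ Set.Ico 0 1) := by
  rcases hp0.eq_or_lt with rfl | hp
  · have : {x : ℝ | (x < 0 ∧ expand 0 x ∈ B) ∧ x ∈ Set.Ico (0 : ℝ) 1} = ∅ := by
      ext x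
      simp only [Set.mem_ofPred_eq, Set.mem_Ico, Set.mem_empty_iff_false, iff_false]
      rintro ⟨⟨h, -⟩, h', -⟩
      linarith
    rw [this]
    simp
  · have h := Real.volume_preimage_mul_right (inv_ne_zero hp.ne') (B ∩ Set.Ico 0 1)
    rw [inv_inv, abs_of_pos hp] at h
    rw [← h]
    congr 1
    ext x
    simp only [Set.mem_ofPred_eq, Set.mem_Ico, Set.mem_preimage, Set.mem_inter_iff,
      ← div_eq_mul_inv, div_lt_one hp]
    constructor
    · rintro ⟨⟨h1, h2⟩, h3, -⟩
      rw [expand, if_pos h1] at h2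
      exact ⟨h2, by positivity, h1⟩
    · rintro ⟨h2, h3, h1⟩
      refine ⟨⟨h1, ?_⟩, ?_, by linarith⟩
      · rwa [expand, if_pos h1]
      · by_contra hx
        exact absurd h3 (not_le.2 (div_neg_of_neg_of_pos (not_le.1 hx) hp))

lemma volume_expand_high {p : ℝ} (hp0 : 0 ≤ p) (hp1 : p ≤ 1) (B : Set ℝ) :
    volume {x | (¬ x < p ∧ expand p x ∈ B) ∧ x ∈ Set.Ico (0 : ℝ) 1} =
      ENNReal.ofReal (1 - p) * volume (B ∩ Set.Ico 0 1) := by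
  rcases hp1.eq_or_lt with rfl | hp
  · have : {x : ℝ | (¬ x < 1 ∧ expand 1 x ∈ B) ∧ x ∈ Set.Ico (0 : ℝ) 1} = ∅ := by
      ext x
      simp only [Set.mem_ofPred_eq, Set.mem_Ico, Set.mem_empty_iff_false, iff_false]
      rintro ⟨⟨h, -⟩, -, h'⟩
      exact h h'
    rw [this]
    simp
  · have hq : 0 < 1 - p := by linarith
    have h := Real.volume_preimage_mul_right (inv_ne_zero hq.ne') (B ∩ Set.Ico 0 1)
    rw [inv_inv, abs_of_pos hq, ← measure_preimage_add_right volume (-p)] at h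
    rw [← h]
    congr 1
    ext x
    simp only [Set.mem_ofPred_eq, Set.mem_Ico, Set.mem_preimage, Set.mem_inter_iff,
      ← div_eq_mul_inv, div_lt_one hq, ← sub_eq_add_neg]
    constructor
    · rintro ⟨⟨h1, h2⟩, h3, h4⟩
      rw [expand, if_neg h1] at h2
      exact ⟨h2, div_nonneg (by linarith) hq.le, by linarith⟩
    · rintro ⟨h2, h3, h1⟩
      have h4 : ¬ x < p := by
        intro hx
        exact absurd h3 (not_le.2 (div_neg_of_neg_of_pos (by linarith) hq))
      refine ⟨⟨h4, ?_⟩, by linarith, by linarith⟩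
      rwa [expand, if_neg h4]

lemma volume_digit_inter {p : ℝ} (hp0 : 0 ≤ p) (hp1 : p ≤ 1) (t : Set Bool) {B : Set ℝ}
    (hB : MeasurableSet B) :
    volume.restrict (Set.Ico (0 : ℝ) 1) {x | decide (x < p) ∈ t ∧ expand p x ∈ B} =
      bern p t * volume.restrict (Set.Ico (0 : ℝ) 1) B := by
  have hlow : MeasurableSet {x : ℝ | x < p ∧ expand p x ∈ B} :=
    measurableSet_Iio.inter (measurable_expand p hB)
  have hhigh : MeasurableSet {x : ℝ | ¬ x < p ∧ expand p x ∈ B} :=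
    measurableSet_Iio.compl.inter (measurable_expand p hB)
  have e1 := volume_expand_low hp0 hp1 B
  have e2 := volume_expand_high hp0 hp1 B
  rw [Set.ofPred_and] at e1 e2
  have e1' : volume.restrict (Set.Ico (0 : ℝ) 1) {x : ℝ | x < p ∧ expand p x ∈ B} =
      ENNReal.ofReal p * volume.restrict (Set.Ico (0 : ℝ) 1) B := by
    rw [Measure.restrict_apply hlow, Measure.restrict_apply hB]; exact e1
  have e2' : volume.restrict (Set.Ico (0 : ℝ) 1) {x : ℝ | ¬ x < p ∧ expand p x ∈ B} =
      ENNReal.ofReal (1 - p) * volume.restrict (Set.Ico (0 : ℝ) 1) B := by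
    rw [Measure.restrict_apply hhigh, Measure.restrict_apply hB]; exact e2
  have key : {x : ℝ | decide (x < p) ∈ t ∧ expand p x ∈ B} =
      {x | true ∈ t ∧ x < p ∧ expand p x ∈ B} ∪ {x | false ∈ t ∧ ¬ x < p ∧ expand p x ∈ B} := by
    ext x
    by_cases hx : x < p
    · simp [hx]
    · simp [hx, not_lt.1 hx]
  rw [key, measure_union, bern_apply, add_mul]
  · congr 1
    · by_cases ht : true ∈ t <;> simp [ht, e1']
    · by_cases ht : false ∈ t
      · simpa [ht] using e2'
      · simp [ht]
  · rw [Set.disjoint_left]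
    rintro x ⟨-, h, -⟩ ⟨-, h', -⟩
    exact h' h
  · by_cases ht : false ∈ t
    · simpa [ht] using hhigh
    · simp [ht]

lemma volume_digits {p : ℝ} (hp0 : 0 ≤ p) (hp1 : p ≤ 1) (n : ℕ) (t : ℕ → Set Bool) :
    volume.restrict (Set.Ico (0 : ℝ) 1) {x | ∀ i < n, bernDigit p i x ∈ t i} =
      ∏ i ∈ Finset.range n, bern p (t i) := by
  induction n generalizing t with
  | zero => simp
  | succ n ih =>
    rw [Finset.prod_range_succ', ← ih (fun i => t (i + 1)), mul_comm, ← volume_digit_inter hp0 hp1]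
    · congr 1
      ext x
      simp only [Set.mem_ofPred_eq]
      constructor
      · intro h
        exact ⟨h 0 n.succ_pos, fun i hi => h (i + 1) (by omega)⟩
      · rintro ⟨h0, h⟩ i hi
        cases i with
        | zero => exact h0
        | succ i => exact h i (by omega)
    · have : {x | ∀ i < n, bernDigit p i x ∈ t (i + 1)} =
          ⋂ i, ⋂ (_ : i < n), bernDigit p i ⁻¹' t (i + 1) := by
        ext x
        simp
      rw [this]
      exact MeasurableSet.iInter fun i => MeasurableSet.iInter fun _ =>
        measurable_bernDigit p i (Set.toFinite _).measurableSet

lemma bernoulliProduct_eq (I : Type*) [Encodable I] {p : ℝ} (hp0 : 0 ≤ p) (hp1 : p ≤ 1) :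
    bernoulliProduct I p = Measure.infinitePi (fun _ : I => bern p) := by
  have := isProbabilityMeasure_bern hp0 hp1
  refine Measure.eq_infinitePi _ fun s t ht => ?_
  have hm : Measurable (fun (x : ℝ) (i : I) => bernDigit p (Encodable.encode i) x) :=
    measurable_pi_iff.2 fun i => measurable_bernDigit p _
  rw [bernoulliProduct, Measure.map_apply hm (MeasurableSet.pi s.countable_toSet fun i _ => ht i)]
  obtain ⟨n, hn⟩ : ∃ n, ∀ i ∈ s, Encodable.encode i < n := by
    refine ⟨s.sup Encodable.encode + 1, fun i hi => Nat.lt_succ_of_le ?_⟩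
    exact Finset.le_sup (f := Encodable.encode) hi
  classical
  let t' : ℕ → Set Bool := fun k => {b | ∀ i ∈ s, Encodable.encode i = k → b ∈ t i}
  have ht' : ∀ i ∈ s, t' (Encodable.encode i) = t i := by
    intro i hi
    ext b
    refine ⟨fun h => h i hi rfl, fun h j _ hj => ?_⟩
    rwa [Encodable.encode_injective hj]
  have h1 := volume_digits hp0 hp1 n t'
  have h2 : (fun (x : ℝ) (i : I) => bernDigit p (Encodable.encode i) x) ⁻¹' (s : Set I).pi t =
      {x | ∀ i < n, bernDigit p i x ∈ t' i} := by
    ext x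
    constructor
    · rintro h k - i hi rfl
      exact h i hi
    · intro h i hi
      have := h _ (hn i hi)
      rwa [ht' i hi] at this
  rw [h2, h1, ← Finset.prod_subset (s₁ := s.image Encodable.encode)]
  · rw [Finset.prod_image (fun a _ b _ h => Encodable.encode_injective h)]
    exact Finset.prod_congr rfl fun i hi => by rw [ht' i hi]
  · intro k hk
    obtain ⟨i, hi, rfl⟩ := Finset.mem_image.1 hk
    exact Finset.mem_range.2 (hn i hi)
  · intro k _ hk
    have : t' k = Set.univ := by
      ext b
      simp only [Set.mem_univ, iff_true]
      rintro i hi rfl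
      exact absurd (Finset.mem_image_of_mem _ hi) hk
    rw [this, measure_univ]

/-- The `σ`-algebra generated by the bits of the edges in `S`. -/
@[reducible] def edgeAlg (S : Set Edge) : MeasurableSpace Config :=
  ⨆ e ∈ S, MeasurableSpace.comap (fun ω : Config => ω e) ⊤

lemma edgeAlg_le (S : Set Edge) : edgeAlg S ≤ MeasurableSpace.pi :=
  iSup₂_le fun e _ => (measurable_pi_apply e).comap_le

lemma measurableSet_edge {S : Set Edge} {e : Edge} (he : e ∈ S) (b : Bool) :
    MeasurableSet[edgeAlg S] {ω | ω e = b} :=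
  le_iSup₂ (f := fun (e : Edge) (_ : e ∈ S) => MeasurableSpace.comap (fun ω : Config => ω e) ⊤)
    e he _ ⟨{b}, trivial, rfl⟩

lemma edgeAlg_mono {S T : Set Edge} (h : S ⊆ T) : edgeAlg S ≤ edgeAlg T :=
  biSup_mono fun _ he => h he

lemma mu_eq {p : ℝ} (hp0 : 0 ≤ p) (hp1 : p ≤ 1) :
    mu p = Measure.infinitePi (fun _ : Edge => bern p) :=
  bernoulliProduct_eq _ hp0 hp1

lemma isProbabilityMeasure_mu {p : ℝ} (hp0 : 0 ≤ p) (hp1 : p ≤ 1) : IsProbabilityMeasure (mu p) := by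
  have := isProbabilityMeasure_bern hp0 hp1
  rw [mu_eq hp0 hp1]
  infer_instance

lemma iIndepFun_mu {p : ℝ} (hp0 : 0 ≤ p) (hp1 : p ≤ 1) : iIndepFun (fun (e : Edge) (ω : Config) => ω e) (mu p) := by
  have := isProbabilityMeasure_bern hp0 hp1
  rw [mu_eq hp0 hp1]
  exact iIndepFun_infinitePi (X := fun _ => id) (fun _ => measurable_id)

lemma indep_edgeAlg {p : ℝ} (hp0 : 0 ≤ p) (hp1 : p ≤ 1) {S T : Set Edge} (h : Disjoint S T) :
    Indep (edgeAlg S) (edgeAlg T) (mu p) :=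
  indep_iSup_of_disjoint (fun e => (measurable_pi_apply e).comap_le) (iIndepFun_mu hp0 hp1) h

lemma mu_inter {p : ℝ} (hp0 : 0 ≤ p) (hp1 : p ≤ 1) {S T : Set Edge} (h : Disjoint S T)
    {A B : Set Config}
    (hA : MeasurableSet[edgeAlg S] A) (hB : MeasurableSet[edgeAlg T] B) :
    mu p (A ∩ B) = mu p A * mu p B :=
  (Indep_iff _ _ _).1 (indep_edgeAlg hp0 hp1 h) A B hA hB

lemma mu_pi {p : ℝ} (hp0 : 0 ≤ p) (hp1 : p ≤ 1) (s : Finset Edge) (t : Edge → Set Bool) :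
    mu p ((s : Set Edge).pi t) = ∏ e ∈ s, bern p (t e) := by
  have := isProbabilityMeasure_bern hp0 hp1
  rw [mu_eq hp0 hp1, Measure.infinitePi_pi]
  exact fun _ _ => (Set.toFinite _).measurableSet

lemma mu_edge_true {p : ℝ} (hp0 : 0 ≤ p) (hp1 : p ≤ 1) (e : Edge) :
    mu p {ω | ω e = true} = ENNReal.ofReal p := by
  have h := mu_pi hp0 hp1 {e} (fun _ => {true})
  rw [Finset.prod_singleton, bern_apply, Finset.coe_singleton, Set.singleton_pi] at h
  exact h.trans (by simp)

lemma mu_edge_false {p : ℝ} (hp0 : 0 ≤ p) (hp1 : p ≤ 1) (e : Edge) :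
    mu p {ω | ω e = false} = ENNReal.ofReal (1 - p) := by
  have h := mu_pi hp0 hp1 {e} (fun _ => {false})
  rw [Finset.prod_singleton, bern_apply, Finset.coe_singleton, Set.singleton_pi] at h
  exact h.trans (by simp)

lemma le_mu_cylinder {p : ℝ} (hp0 : 0 ≤ p) (hp1 : p ≤ 1) (s : Finset Edge) (c : Edge → Bool) :
    (min (ENNReal.ofReal p) (ENNReal.ofReal (1 - p))) ^ s.card ≤
      mu p {ω | ∀ e ∈ s, ω e = c e} := by
  have h := mu_pi hp0 hp1 s (fun e => {c e})
  have h2 : (s : Set Edge).pi (fun e => {c e}) = {ω | ∀ e ∈ s, ω e = c e} := by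
    ext ω
    simp [Set.mem_pi]
  rw [h2] at h
  rw [h]
  refine Finset.pow_card_le_prod _ _ _ fun e _ => ?_
  rw [bern_apply]
  cases c e <;> simp

lemma mu_preimage_comp {p : ℝ} (hp0 : 0 ≤ p) (hp1 : p ≤ 1) {σ : Edge → Edge}
    (hσ : σ.Injective) {A : Set Config}
    (hA : MeasurableSet A) : mu p {ω | (fun e => ω (σ e)) ∈ A} = mu p A := by
  have hb := isProbabilityMeasure_bern hp0 hp1
  have h1 : iIndepFun (fun (e : Edge) (ω : Config) => ω (σ e)) (mu p) :=
    (iIndepFun_mu hp0 hp1).precomp hσ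
  have h2 := h1.map_fun_eq_infinitePi_map (fun e => measurable_pi_apply (σ e))
  have h3 : ∀ e, (mu p).map (fun ω => ω (σ e)) = bern p := by
    intro e
    rw [mu_eq hp0 hp1]
    exact Measure.infinitePi_map_eval _ (σ e)
  simp_rw [h3] at h2
  rw [← mu_eq hp0 hp1] at h2
  conv_rhs => rw [← h2, Measure.map_apply
    (measurable_pi_iff.2 fun e => measurable_pi_apply (σ e)) hA]
  rfl

lemma map_not_bern (p : ℝ) : (bern p).map not = bern (1 - p) := by
  ext t ht
  rw [Measure.map_apply (by fun_prop) ht, bern_apply, bern_apply, add_comm]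
  have h1 : (not ⁻¹' t).indicator (1 : Bool → ℝ≥0∞) false = t.indicator 1 true := rfl
  have h2 : (not ⁻¹' t).indicator (1 : Bool → ℝ≥0∞) true = t.indicator 1 false := rfl
  rw [h1, h2, _root_.sub_sub_cancel]

lemma mu_preimage_not_comp {p : ℝ} (hp0 : 0 ≤ p) (hp1 : p ≤ 1) {σ : Edge → Edge}
    (hσ : σ.Injective) {A : Set Config}
    (hA : MeasurableSet A) : mu p {ω | (fun e => !ω (σ e)) ∈ A} = mu (1 - p) A := by
  have hb := isProbabilityMeasure_bern hp0 hp1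
  have hm : Measurable (fun (ω : Config) (e : Edge) => !ω e) :=
    measurable_pi_iff.2 fun e => (measurable_of_finite not).comp (measurable_pi_apply e)
  refine (mu_preimage_comp hp0 hp1 hσ (hm hA)).trans ?_
  rw [← Measure.map_apply hm hA, mu_eq hp0 hp1, mu_eq (p := 1 - p) (by linarith) (by linarith)]
  have h := Measure.infinitePi_map_pi (μ := fun _ : Edge => bern p) (f := fun _ => not)
    (fun _ => measurable_of_finite not)
  rw [h]
  simp_rw [map_not_bern]

/-! ### Reachability inside a vertex set -/

/-- `v` can be reached from `u` by steps of `R` between vertices of `V`. -/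
def reach (R : ℤ × ℤ → ℤ × ℤ → Prop) (V : Set (ℤ × ℤ)) (u v : ℤ × ℤ) : Prop :=
  Relation.ReflTransGen (fun x y => x ∈ V ∧ y ∈ V ∧ R x y) u v

lemma reach_mono {R : ℤ × ℤ → ℤ × ℤ → Prop} {V W : Set (ℤ × ℤ)} (h : V ⊆ W) {u v : ℤ × ℤ}
    (huv : reach R V u v) : reach R W u v :=
  Relation.ReflTransGen.mono (fun _ _ hxy => ⟨h hxy.1, h hxy.2.1, hxy.2.2⟩) _ _ huv

lemma reach_mem {R : ℤ × ℤ → ℤ × ℤ → Prop} {V : Set (ℤ × ℤ)} {u v : ℤ × ℤ} (hu : u ∈ V)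
    (huv : reach R V u v) : v ∈ V := by
  induction huv with
  | refl => exact hu
  | tail _ h _ => exact h.2.1

/-- `v` can be reached from `u` by `n` steps of `R` between vertices of `V`. -/
def reachIn (R : ℤ × ℤ → ℤ × ℤ → Prop) (V : Set (ℤ × ℤ)) (u : ℤ × ℤ) : ℕ → ℤ × ℤ → Prop
  | 0, v => u = v
  | n + 1, v => ∃ w, reachIn R V u n w ∧ w ∈ V ∧ v ∈ V ∧ R w v

lemma reach_iff_exists_reachIn {R : ℤ × ℤ → ℤ × ℤ → Prop} {V : Set (ℤ × ℤ)} {u v : ℤ × ℤ} :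
    reach R V u v ↔ ∃ n, reachIn R V u n v := by
  constructor
  · intro h
    induction h with
    | refl => exact ⟨0, rfl⟩
    | tail _ h ih =>
      obtain ⟨n, hn⟩ := ih
      exact ⟨n + 1, _, hn, h⟩
  · rintro ⟨n, hn⟩
    induction n generalizing v with
    | zero => exact hn ▸ Relation.ReflTransGen.refl
    | succ n ih =>
      obtain ⟨w, hw, h⟩ := hn
      exact (ih hw).tail h

lemma measurableSet_reach {m : MeasurableSpace Config} {R : Config → ℤ × ℤ → ℤ × ℤ → Prop}
    {V : Set (ℤ × ℤ)} (h : ∀ x ∈ V, ∀ y ∈ V, MeasurableSet {ω | R ω x y}) (u v : ℤ × ℤ) :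
    MeasurableSet {ω | reach (R ω) V u v} := by
  have h1 : ∀ n v, MeasurableSet {ω | reachIn (R ω) V u n v} := by
    intro n
    induction n with
    | zero => exact fun v => MeasurableSet.const (u = v)
    | succ n ih =>
      intro v
      have : {ω | reachIn (R ω) V u (n + 1) v} =
          ⋃ w, {ω | reachIn (R ω) V u n w} ∩ {ω | w ∈ V ∧ v ∈ V ∧ R ω w v} := by
        ext ω
        simp [reachIn]
      rw [this]
      refine MeasurableSet.iUnion fun w => (ih w).inter ?_
      by_cases hw : w ∈ V
      · by_cases hv : v ∈ V
        · simpa [hw, hv] using h w hw v hv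
        · simp [hv]
      · simp [hw]
  have h2 : {ω | reach (R ω) V u v} = ⋃ n, {ω | reachIn (R ω) V u n v} := by
    ext ω
    simp [reach_iff_exists_reachIn]
  rw [h2]
  exact MeasurableSet.iUnion fun n => h1 n v

/-! ### The random-orientation model in the quadrant -/

lemma gStep_iff {ω : Config} {u v : ℤ × ℤ} : gStep ω u v ↔
    (v = (u.1 + 1, u.2) ∧ ω (u, false) = true) ∨ (v = (u.1, u.2 + 1) ∧ ω (u, true) = true) ∨
    (u = (v.1 + 1, v.2) ∧ ω (v, false) = false) ∨ (u = (v.1, v.2 + 1) ∧ ω (v, true) = false) := by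
  constructor
  · rintro ⟨⟨w, b⟩, ⟨rfl, rfl, h⟩ | ⟨rfl, rfl, h⟩⟩ <;> cases b <;> simp_all [eSrc, eDst]
  · rintro (⟨rfl, h⟩ | ⟨rfl, h⟩ | ⟨rfl, h⟩ | ⟨rfl, h⟩)
    · exact ⟨(u, false), Or.inl ⟨rfl, rfl, h⟩⟩
    · exact ⟨(u, true), Or.inl ⟨rfl, rfl, h⟩⟩
    · exact ⟨(v, false), Or.inr ⟨rfl, rfl, h⟩⟩
    · exact ⟨(v, true), Or.inr ⟨rfl, rfl, h⟩⟩

lemma measurableSet_and_edge {S : Set Edge} {e : Edge} {c : Prop} (h : c → e ∈ S) (b : Bool) :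
    MeasurableSet[edgeAlg S] {ω | c ∧ ω e = b} := by
  by_cases hc : c
  · simp only [hc, true_and]
    exact measurableSet_edge (h hc) b
  · simp only [hc, false_and]
    exact MeasurableSet.const False

lemma measurableSet_gStep {S : Set Edge} {u v : ℤ × ℤ}
    (h : ∀ e, (eSrc e = u ∧ eDst e = v) ∨ (eSrc e = v ∧ eDst e = u) → e ∈ S) :
    MeasurableSet[edgeAlg S] {ω | gStep ω u v} := by
  have : {ω | gStep ω u v} = ⋃ e : Edge, ({ω : Config | (eSrc e = u ∧ eDst e = v) ∧ ω e = true} ∪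
      {ω | (eSrc e = v ∧ eDst e = u) ∧ ω e = false}) := by
    ext ω
    simp [gStep, and_assoc]
  rw [this]
  exact MeasurableSet.iUnion fun e =>
    (measurableSet_and_edge (fun h' => h e (Or.inl h')) true).union
      (measurableSet_and_edge (fun h' => h e (Or.inr h')) false)

/-- The strip `[0, a] × [0, ∞)` with the `N × N` box at its lower right corner removed. -/
def strip (N a : ℕ) : Set (ℤ × ℤ) :=
  {u | 0 ≤ u.1 ∧ u.1 ≤ a ∧ 0 ≤ u.2 ∧ ¬((a : ℤ) - N < u.1 ∧ u.2 < N)}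

lemma strip_subset (N a : ℕ) : strip N a ⊆ NEquad := fun _ h => ⟨h.1, h.2.2.1⟩

lemma zero_mem_strip {N a : ℕ} (h : N ≤ a) : ((0, 0) : ℤ × ℤ) ∈ strip N a := by
  simp only [strip, Set.mem_ofPred_eq]
  omega

/-- The column `x = a` is reached inside `strip N a`. -/
def crossing (N a : ℕ) (ω : Config) : Prop :=
  ∃ b : ℕ, reach (gStep ω) (strip N a) (0, 0) ((a : ℤ), (b : ℤ))

/-- The corner of `strip N a` is approached but the strip is not crossed. -/
def trapped (N a : ℕ) (ω : Config) : Prop :=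
  ¬ crossing N a ω ∧ ∃ u, reach (gStep ω) (strip N a) (0, 0) u ∧ (a : ℤ) - N ≤ u.1

/-- The edges joining `strip N a` to its missing corner. -/
def cornerEdges (N a : ℕ) : Finset Edge :=
  (Finset.range N).image (fun y : ℕ => (((a : ℤ) - N, (y : ℤ)), false)) ∪
    (Finset.range N).image (fun i : ℕ => (((a : ℤ) - i, (N : ℤ) - 1), true))

/-- All edges joining `strip N a` to its missing corner point out of the corner. -/
def sealed (N a : ℕ) (ω : Config) : Prop := ∀ e ∈ cornerEdges N a, ω e = e.2

/-- In every row some edge in the first `a` columns points upwards. -/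
def climbable (a : ℕ) (ω : Config) : Prop :=
  ∀ h : ℕ, ∃ x < a, ω (((x : ℤ), (h : ℤ)), true) = true

lemma percolates_climbable {ω : Config} {a : ℕ} {γ : ℕ → ℤ × ℤ} (h0 : γ 0 = (0, 0))
    (hinj : Function.Injective γ) (hstep : ∀ n, gStep ω (γ n) (γ (n + 1)))
    (hquad : ∀ n, γ n ∈ NEquad) (hlt : ∀ n, (γ n).1 < a) : climbable a ω := by
  intro h
  have hex : ∃ n, (h : ℤ) < (γ n).2 := by
    by_contra hcon
    push Not at hcon
    have hsub : Set.range γ ⊆ Set.Icc (0 : ℤ) a ×ˢ Set.Icc (0 : ℤ) h := by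
      rintro _ ⟨n, rfl⟩
      exact ⟨⟨(hquad n).1, (hlt n).le⟩, ⟨(hquad n).2, hcon n⟩⟩
    exact Set.infinite_range_of_injective hinj
      (((Set.finite_Icc _ _).prod (Set.finite_Icc _ _)).subset hsub)
  classical
  obtain ⟨n, hn, hmin⟩ : ∃ n, (h : ℤ) < (γ n).2 ∧ ∀ m < n, ¬ (h : ℤ) < (γ m).2 :=
    ⟨Nat.find hex, Nat.find_spec hex, fun m hm => Nat.find_min hex hm⟩
  cases n with
  | zero =>
    rw [h0] at hn
    simp at hn
    omega
  | succ n =>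
    have hm := hmin n n.lt_succ_self
    have hq := (hquad n).1
    have hl := hlt n
    refine ⟨(γ n).1.toNat, by omega, ?_⟩
    rcases gStep_iff.1 (hstep n) with ⟨e, -⟩ | ⟨e, hω⟩ | ⟨e, -⟩ | ⟨e, -⟩
    · rw [e] at hn
      exact absurd hn hm
    · rw [e] at hn
      have h2 : (γ n).2 = h := by
        simp only at hn
        omega
      have h1 : (((γ n).1.toNat : ℤ), (h : ℤ)) = γ n := by
        rw [Int.toNat_of_nonneg hq, ← h2]
      rw [h1]
      exact hω
    · have := congrArg Prod.snd e
      simp only at this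
      omega
    · have := congrArg Prod.snd e
      simp only at this
      omega

lemma gStep_fst_le {ω : Config} {u v : ℤ × ℤ} (h : gStep ω u v) : v.1 ≤ u.1 + 1 := by
  rcases gStep_iff.1 h with ⟨e, -⟩ | ⟨e, -⟩ | ⟨e, -⟩ | ⟨e, -⟩ <;>
    have := congrArg Prod.fst e <;> simp only at this <;> omega

lemma percolates_cases {ω : Config} {N a : ℕ} (hN : 0 < N) (hNa : N ≤ a)
    (h : percolates (gStep ω) NEquad) : crossing N a ω ∨ trapped N a ω ∨ climbable a ω := by
  obtain ⟨γ, h0, hinj, hstep, hquad⟩ := h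
  by_cases hex : ∃ u, reach (gStep ω) (strip N a) (0, 0) u ∧ (a : ℤ) - N ≤ u.1
  · by_cases hc : crossing N a ω
    · exact Or.inl hc
    · exact Or.inr (Or.inl ⟨hc, hex⟩)
  · push Not at hex
    have hr : ∀ n, reach (gStep ω) (strip N a) (0, 0) (γ n) := by
      intro n
      induction n with
      | zero =>
        rw [h0]
        exact Relation.ReflTransGen.refl
      | succ n ih =>
        have h1 := hex _ ih
        have h2 := gStep_fst_le (hstep n)
        have h3 := hquad (n + 1)
        refine ih.tail ⟨reach_mem (zero_mem_strip hNa) ih, ⟨h3.1, by omega, h3.2, ?_⟩, hstep n⟩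
        omega
    refine Or.inr (Or.inr (percolates_climbable h0 hinj hstep hquad fun n => ?_))
    have := hex _ (hr n)
    omega

/-- A sealed trap confines everything that can be reached in the quadrant. -/
lemma reach_fst_lt {ω : Config} {N a : ℕ} (hN : 0 < N) (hNa : N ≤ a) (ht : ¬ crossing N a ω)
    (hs : sealed N a ω) {v : ℤ × ℤ} (hv : reach (gStep ω) NEquad (0, 0) v) : v.1 < a := by
  have key : reach (gStep ω) (strip N a) (0, 0) v ∧ v.1 < a := by
    induction hv with
    | refl => exact ⟨Relation.ReflTransGen.refl, by simp; omega⟩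
    | @tail u v _ huv ih =>
      obtain ⟨hu, hua⟩ := ih
      obtain ⟨-, hvq, hstep⟩ := huv
      have hus := reach_mem (zero_mem_strip hNa) hu
      have hle := gStep_fst_le hstep
      have hvs : v ∈ strip N a := by
        refine ⟨hvq.1, by omega, hvq.2, ?_⟩
        rintro ⟨h1, h2⟩
        obtain ⟨hu1, hu2, hu3, hu4⟩ := hus
        rcases gStep_iff.1 hstep with ⟨e, hω⟩ | ⟨e, hω⟩ | ⟨e, hω⟩ | ⟨e, hω⟩
        · rw [e] at h1 h2
          simp only at h1 h2
          have hm : (u, false) ∈ cornerEdges N a := by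
            refine Finset.mem_union_left _ (Finset.mem_image.2 ⟨u.2.toNat, ?_, ?_⟩)
            · rw [Finset.mem_range]
              omega
            · rw [Int.toNat_of_nonneg hu3]
              ext <;> simp
              omega
          have := hs _ hm
          simp_all
        · rw [e] at h1 h2
          simp only at h1 h2
          omega
        · rw [e] at hu4 hua
          simp only at hu4 hua
          omega
        · rw [e] at hu4 hua
          simp only at hu4 hua
          have hm : (v, true) ∈ cornerEdges N a := by
            refine Finset.mem_union_right _ (Finset.mem_image.2 ⟨((a : ℤ) - v.1).toNat, ?_, ?_⟩)
            · rw [Finset.mem_range]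
              omega
            · rw [Int.toNat_of_nonneg (by omega)]
              ext <;> simp
              omega
          have := hs _ hm
          simp_all
      have hr : reach (gStep ω) (strip N a) (0, 0) v := hu.tail ⟨hus, hvs, hstep⟩
      refine ⟨hr, lt_of_le_of_ne hvs.2.1 fun h => ht ⟨v.2.toNat, ?_⟩⟩
      rw [Int.toNat_of_nonneg hvq.2, ← h]
      exact hr
  exact key.2

/-- The edges inside `strip N a`. -/
def stripEdges (N a : ℕ) : Set Edge := {e | eSrc e ∈ strip N a ∧ eDst e ∈ strip N a}

lemma measurableSet_reach_strip (N a : ℕ) (v : ℤ × ℤ) :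
    MeasurableSet[edgeAlg (stripEdges N a)] {ω | reach (gStep ω) (strip N a) (0, 0) v} := by
  refine measurableSet_reach (m := edgeAlg (stripEdges N a)) (fun x hx y hy => ?_) _ _
  refine measurableSet_gStep fun e he => ?_
  rcases he with ⟨rfl, rfl⟩ | ⟨rfl, rfl⟩
  · exact ⟨hx, hy⟩
  · exact ⟨hy, hx⟩

lemma measurableSet_crossing (N a : ℕ) :
    MeasurableSet[edgeAlg (stripEdges N a)] {ω | crossing N a ω} := by
  have : {ω | crossing N a ω} =
      ⋃ b : ℕ, {ω | reach (gStep ω) (strip N a) (0, 0) ((a : ℤ), (b : ℤ))} := by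
    ext ω
    simp [crossing]
  rw [this]
  exact MeasurableSet.iUnion fun b => measurableSet_reach_strip N a _

lemma measurableSet_trapped (N a : ℕ) :
    MeasurableSet[edgeAlg (stripEdges N a)] {ω | trapped N a ω} := by
  have : {ω | trapped N a ω} = {ω | crossing N a ω}ᶜ ∩
      ⋃ u : ℤ × ℤ, {ω | reach (gStep ω) (strip N a) (0, 0) u} ∩ {_ω | (a : ℤ) - N ≤ u.1} := by
    ext ω
    simp [trapped]
  rw [this]
  exact (measurableSet_crossing N a).compl.inter (MeasurableSet.iUnion fun u =>
    (measurableSet_reach_strip N a _).inter (MeasurableSet.const _))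

lemma measurableSet_cylinder (s : Finset Edge) (c : Edge → Bool) :
    MeasurableSet[edgeAlg s] {ω | ∀ e ∈ s, ω e = c e} := by
  have : {ω : Config | ∀ e ∈ s, ω e = c e} = ⋂ e ∈ s, {ω | ω e = c e} := by
    ext ω
    simp
  rw [this]
  exact MeasurableSet.biInter s.countable_toSet fun e he => measurableSet_edge he _

lemma disjoint_stripEdges_cornerEdges (N a : ℕ) :
    Disjoint (stripEdges N a) (cornerEdges N a : Set Edge) := by
  rw [Set.disjoint_left]
  rintro e ⟨h1, h2⟩ he
  rcases Finset.mem_union.1 he with he | he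
  · obtain ⟨y, hy, rfl⟩ := Finset.mem_image.1 he
    rw [Finset.mem_range] at hy
    simp [strip, eDst] at h2
    omega
  · obtain ⟨y, hy, rfl⟩ := Finset.mem_image.1 he
    rw [Finset.mem_range] at hy
    simp [strip, eSrc] at h1
    omega

/-! ### Crossing probabilities -/

/-- `climbable`, restricted to the first `H` rows. -/
def climbableBelow (a H : ℕ) (ω : Config) : Prop :=
  ∀ h < H, ∃ x < a, ω (((x : ℤ), (h : ℤ)), true) = true

/-- The upward edges in row `h` and the first `a` columns. -/
def rowEdges (a h : ℕ) : Finset Edge :=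
  (Finset.range a).image fun x : ℕ => (((x : ℤ), (h : ℤ)), true)

lemma measurableSet_climbableBelow (a H : ℕ) :
    MeasurableSet[edgeAlg {e | e.1.2 < H}] {ω | climbableBelow a H ω} := by
  have : {ω | climbableBelow a H ω} =
      ⋂ h : ℕ, ⋂ _ : h < H, ⋃ x : ℕ, ⋃ _ : x < a, {ω | ω (((x : ℤ), (h : ℤ)), true) = true} := by
    ext ω
    simp [climbableBelow]
  rw [this]
  refine MeasurableSet.iInter fun h => MeasurableSet.iInter fun hh => MeasurableSet.iUnion fun x =>
    MeasurableSet.iUnion fun _ => measurableSet_edge ?_ _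
  simpa using hh

lemma climbableBelow_succ (a H : ℕ) : {ω | climbableBelow a (H + 1) ω} =
    {ω | climbableBelow a H ω} ∩ {ω | ∀ e ∈ rowEdges a H, ω e = (fun _ => false) e}ᶜ := by
  ext ω
  simp only [climbableBelow, rowEdges, Set.mem_ofPred_eq, Set.mem_inter_iff, Set.mem_compl_iff,
    Finset.mem_image, Finset.mem_range, forall_exists_index, and_imp, forall_apply_eq_imp_iff₂,
    not_forall, Nat.lt_succ_iff_lt_or_eq, or_imp, forall_and, forall_eq]
  simp

lemma mu_climbable {q : ℝ} (hq0 : 0 < q) (hq1 : q < 1) (a : ℕ) :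
    mu q {ω | climbable a ω} = 0 := by
  have := isProbabilityMeasure_mu hq0.le hq1.le
  set c : ℝ≥0∞ := min (ENNReal.ofReal q) (ENNReal.ofReal (1 - q)) with hc
  have hc0 : 0 < c := lt_min (by simpa using hq0) (by simpa using hq1)
  have key : ∀ H, mu q {ω | climbableBelow a H ω} ≤ (1 - c ^ a) ^ H := by
    intro H
    induction H with
    | zero => simpa using prob_le_one
    | succ H ih =>
      have hd : Disjoint {e : Edge | e.1.2 < (H : ℤ)} (rowEdges a H : Set Edge) := by
        rw [Set.disjoint_left]
        rintro e he he'
        obtain ⟨x, -, rfl⟩ := Finset.mem_image.1 he'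
        simp at he
      have hm := measurableSet_cylinder (rowEdges a H) (fun _ => false)
      rw [climbableBelow_succ, mu_inter hq0.le hq1.le hd (measurableSet_climbableBelow a H)
        hm.compl, prob_compl_eq_one_sub (edgeAlg_le _ _ hm), pow_succ]
      gcongr
      refine le_trans ?_ (le_mu_cylinder hq0.le hq1.le _ _)
      have hcard : (rowEdges a H).card ≤ a := by
        exact Finset.card_image_le.trans (by simp)
      refine pow_le_pow_right_of_le_one' ?_ hcard
      exact (min_le_left _ _).trans (by simpa using hq1.le)
  have hlim : Tendsto (fun H : ℕ => (1 - c ^ a) ^ H) atTop (𝓝 0) :=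
    ENNReal.tendsto_pow_atTop_nhds_zero_of_lt_one
      (ENNReal.sub_lt_self ENNReal.one_ne_top one_ne_zero (ENNReal.pow_pos hc0 a).ne')
  refine le_antisymm (ge_of_tendsto' hlim fun H => ?_) zero_le
  have hsub : {ω | climbable a ω} ⊆ {ω | climbableBelow a H ω} := fun ω hω h _ => hω h
  exact (measure_mono hsub).trans (key H)

lemma mu_trapped_le {q : ℝ} (hq0 : 0 < q) (hq1 : q < 1) (N a : ℕ) :
    mu q {ω | trapped N a ω} * min (ENNReal.ofReal q) (ENNReal.ofReal (1 - q)) ^ (2 * N) ≤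
      mu q {ω | trapped N a ω ∧ sealed N a ω} := by
  have h := mu_inter hq0.le hq1.le (disjoint_stripEdges_cornerEdges N a)
    (measurableSet_trapped N a) (measurableSet_cylinder (cornerEdges N a) fun e => e.2)
  have h2 : {ω | trapped N a ω ∧ sealed N a ω} =
      {ω | trapped N a ω} ∩ {ω | ∀ e ∈ cornerEdges N a, ω e = (fun e : Edge => e.2) e} := rfl
  rw [h2, h]
  gcongr
  refine le_trans ?_ (le_mu_cylinder hq0.le hq1.le _ _)
  have hcard : (cornerEdges N a).card ≤ 2 * N := by
    refine (Finset.card_union_le _ _).trans ?_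
    rw [two_mul]
    exact add_le_add (Finset.card_image_le.trans (by simp)) (Finset.card_image_le.trans (by simp))
  refine pow_le_pow_right_of_le_one' ?_ hcard
  exact (min_le_left _ _).trans (by simpa using hq1.le)

lemma tendsto_mu_trapped {q : ℝ} (hq0 : 0 < q) (hq1 : q < 1) {N : ℕ} (hN : 0 < N) :
    Tendsto (fun a => mu q {ω | trapped N a ω}) atTop (𝓝 0) := by
  have := isProbabilityMeasure_mu hq0.le hq1.le
  set c : ℝ≥0∞ := min (ENNReal.ofReal q) (ENNReal.ofReal (1 - q)) ^ (2 * N) with hc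
  have hc0 : c ≠ 0 :=
    (ENNReal.pow_pos (lt_min (by simpa using hq0) (by simpa using hq1)) _).ne'
  have hct : c ≠ ⊤ := ENNReal.pow_ne_top (ne_top_of_le_ne_top ENNReal.ofReal_ne_top (min_le_left _ _))
  let D : ℕ → Set Config := fun a => {ω | trapped N a ω ∧ sealed N a ω}
  have hDm : ∀ a, MeasurableSet (D a) := fun a =>
    (edgeAlg_le _ _ (measurableSet_trapped N a)).inter
      (edgeAlg_le _ _ (measurableSet_cylinder (cornerEdges N a) fun e => e.2))
  have hanti : Antitone fun a => ⋃ b ≥ a, D b := fun a a' h =>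
    Set.biUnion_subset_biUnion_left fun b hb => le_trans h hb
  have hempty : ⋂ a, ⋃ b ≥ a, D b = ∅ := by
    rw [Set.eq_empty_iff_forall_notMem]
    intro ω hω
    rw [Set.mem_iInter] at hω
    obtain ⟨a, ha, hDa⟩ := Set.mem_iUnion₂.1 (hω N)
    obtain ⟨b, hb, hDb⟩ := Set.mem_iUnion₂.1 (hω (a + N))
    obtain ⟨u, hu, hub⟩ := hDb.1.2
    have := reach_fst_lt hN ha hDa.1.1 hDa.2 (reach_mono (strip_subset N b) hu)
    omega
  have h1 : Tendsto (fun a => mu q (⋃ b ≥ a, D b)) atTop (𝓝 0) := by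
    have := tendsto_measure_iInter_atTop (μ := mu q) (s := fun a => ⋃ b ≥ a, D b)
      (fun a => (MeasurableSet.iUnion fun b => MeasurableSet.iUnion fun _ =>
        hDm b).nullMeasurableSet) hanti ⟨0, measure_ne_top _ _⟩
    rwa [hempty, measure_empty] at this
  have h2 : Tendsto (fun a => mu q (⋃ b ≥ a, D b) / c) atTop (𝓝 0) := by
    simpa using ENNReal.Tendsto.div_const h1 (Or.inr hc0)
  refine tendsto_of_tendsto_of_tendsto_of_le_of_le tendsto_const_nhds h2 (fun _ => zero_le)
    fun a => ?_
  rw [ENNReal.le_div_iff_mul_le (Or.inl hc0) (Or.inl hct)]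
  exact (mu_trapped_le hq0 hq1 N a).trans
    (measure_mono (Set.subset_biUnion_of_mem (u := D) (show a ≥ a from le_rfl)))

lemma pos_of_thetaNE_pos {q : ℝ} (hq0 : 0 ≤ q) (hq1 : q ≤ 1) (h : 0 < thetaNE q) : 0 < q := by
  refine lt_of_le_of_ne hq0 fun h0 => h.ne' (le_antisymm ?_ zero_le)
  have hsub : {ω | percolates (gStep ω) NEquad} ⊆
      {ω : Config | ω ((0, 0), false) = true} ∪ {ω | ω ((0, 0), true) = true} := by
    rintro ω ⟨γ, hγ0, -, hstep, hquad⟩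
    have hs := hstep 0
    have hq := hquad 1
    rw [hγ0] at hs
    rcases gStep_iff.1 hs with ⟨-, h⟩ | ⟨-, h⟩ | ⟨e, -⟩ | ⟨e, -⟩
    · exact Or.inl h
    · exact Or.inr h
    · have := congrArg Prod.fst e
      have := hq.1
      simp only [zero_add] at *
      omega
    · have := congrArg Prod.snd e
      have := hq.2
      simp only [zero_add] at *
      omega
  refine (measure_mono hsub).trans ((measure_union_le _ _).trans ?_)
  rw [mu_edge_true hq0 hq1, mu_edge_true hq0 hq1, ← h0]
  simp

lemma crossing_of_forall_true {ω : Config} (hω : ∀ e, ω e = true) {N a : ℕ} (h : N ≤ a) :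
    crossing N a ω := by
  refine ⟨N, ?_⟩
  have h1 : ∀ y : ℕ, y ≤ N → reach (gStep ω) (strip N a) (0, 0) (0, (y : ℤ)) := by
    intro y
    induction y with
    | zero => exact fun _ => Relation.ReflTransGen.refl
    | succ y ih =>
      intro hy
      refine (ih (by omega)).tail ⟨?_, ?_, gStep_iff.2 (Or.inr (Or.inl ⟨by simp, hω _⟩))⟩ <;>
      · simp only [strip, Set.mem_ofPred_eq]
        push_cast
        refine ⟨trivial, ?_⟩
        omega
  have h2 : ∀ x : ℕ, x ≤ a → reach (gStep ω) (strip N a) (0, 0) ((x : ℤ), (N : ℤ)) := by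
    intro x
    induction x with
    | zero => exact fun _ => h1 N le_rfl
    | succ x ih =>
      intro hx
      refine (ih (by omega)).tail ⟨?_, ?_, gStep_iff.2 (Or.inl ⟨by simp, hω _⟩)⟩ <;>
      · simp only [strip, Set.mem_ofPred_eq]
        push_cast
        omega
  exact h2 a le_rfl

lemma ae_forall_true : ∀ᵐ ω ∂mu 1, ∀ e, ω e = true := by
  rw [ae_all_iff]
  intro e
  have h := mu_edge_false (p := 1) zero_le_one le_rfl e
  rw [sub_self, ENNReal.ofReal_zero] at h
  simpa [ae_iff] using h

lemma exists_forall_lt_mu_crossing {q : ℝ} (hq0 : 0 ≤ q) (hq1 : q ≤ 1) (hθ : 0 < thetaNE q) {N : ℕ}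
    (hN : 0 < N) : ∃ A, N ≤ A ∧ ∀ a ≥ A, thetaNE q / 2 < mu q {ω | crossing N a ω} := by
  have := isProbabilityMeasure_mu hq0 hq1
  have hθt : thetaNE q ≠ ⊤ := measure_ne_top _ _
  have hθ2 : thetaNE q / 2 < thetaNE q := ENNReal.half_lt_self hθ.ne' hθt
  rcases hq1.eq_or_lt with rfl | hq1'
  · refine ⟨N, le_rfl, fun a ha => ?_⟩
    have h1 : mu 1 {ω | crossing N a ω} = 1 := by
      rw [← prob_compl_eq_zero_iff (edgeAlg_le _ _ (measurableSet_crossing N a))]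
      have : ∀ᵐ ω ∂mu 1, crossing N a ω := by
        filter_upwards [ae_forall_true] with ω hω
        exact crossing_of_forall_true hω ha
      exact this
    rw [h1]
    exact hθ2.trans_le prob_le_one
  · have hq0' := pos_of_thetaNE_pos hq0 hq1 hθ
    have hev := (tendsto_mu_trapped hq0' hq1' hN).eventually_lt_const (ENNReal.half_pos hθ.ne')
    obtain ⟨A, hA⟩ := eventually_atTop.1 hev
    refine ⟨max A N, le_max_right _ _, fun a ha => ?_⟩
    have ha1 := hA a ((le_max_left _ _).trans ha)
    by_contra hcon
    push Not at hcon
    have hsub : {ω | percolates (gStep ω) NEquad} ⊆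
        {ω | crossing N a ω} ∪ ({ω | trapped N a ω} ∪ {ω | climbable a ω}) :=
      fun ω hω => percolates_cases hN ((le_max_right _ _).trans ha) hω
    have h1 : thetaNE q ≤ mu q {ω | crossing N a ω} + mu q {ω | trapped N a ω} := by
      refine (measure_mono hsub).trans ((measure_union_le _ _).trans ?_)
      refine add_le_add le_rfl ((measure_union_le _ _).trans ?_)
      rw [mu_climbable hq0' hq1', add_zero]
    have h2 : mu q {ω | crossing N a ω} + mu q {ω | trapped N a ω} < thetaNE q := by
      conv_rhs => rw [← ENNReal.add_halves (thetaNE q)]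
      exact ENNReal.add_lt_add_of_le_of_lt (measure_ne_top _ _) hcon ha1
    exact absurd h1 (not_le.2 h2)

/-- The part of `strip N a` below height `M`. -/
def truncStrip (N M a : ℕ) : Set (ℤ × ℤ) := {u | u ∈ strip N a ∧ u.2 < M}

/-- The column `x = a` is reached inside `truncStrip N M a`. -/
def truncCrossing (N M a : ℕ) (ω : Config) : Prop :=
  ∃ b : ℕ, reach (gStep ω) (truncStrip N M a) (0, 0) ((a : ℤ), (b : ℤ))

lemma truncStrip_mono {N M M' a : ℕ} (h : M ≤ M') : truncStrip N M a ⊆ truncStrip N M' a :=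
  fun _ hu => ⟨hu.1, hu.2.trans_le (by exact_mod_cast h)⟩

lemma truncCrossing_mono {N M M' a : ℕ} (h : M ≤ M') {ω : Config} (hω : truncCrossing N M a ω) :
    truncCrossing N M' a ω :=
  hω.imp fun _ hb => reach_mono (truncStrip_mono h) hb

lemma exists_reach_truncStrip {ω : Config} {N a : ℕ} {v : ℤ × ℤ}
    (h : reach (gStep ω) (strip N a) (0, 0) v) :
    ∃ M, reach (gStep ω) (truncStrip N M a) (0, 0) v := by
  induction h with
  | refl => exact ⟨0, Relation.ReflTransGen.refl⟩
  | @tail u v _ huv ih =>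
    obtain ⟨M, hM⟩ := ih
    refine ⟨max M (max (u.2.toNat + 1) (v.2.toNat + 1)),
      (reach_mono (truncStrip_mono (le_max_left _ _)) hM).tail
        ⟨⟨huv.1, ?_⟩, ⟨huv.2.1, ?_⟩, huv.2.2⟩⟩ <;>
    · push_cast
      omega

lemma measurableSet_truncCrossing (N M a : ℕ) : MeasurableSet {ω | truncCrossing N M a ω} := by
  have : {ω | truncCrossing N M a ω} =
      ⋃ b : ℕ, {ω | reach (gStep ω) (truncStrip N M a) (0, 0) ((a : ℤ), (b : ℤ))} := by
    ext ω
    simp [truncCrossing]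
  rw [this]
  exact MeasurableSet.iUnion fun b => measurableSet_reach (fun x _ y _ =>
    edgeAlg_le _ _ (measurableSet_gStep (S := Set.univ) fun e _ => Set.mem_univ e)) _ _

lemma exists_lt_mu_truncCrossing {q : ℝ} {N a : ℕ} {c : ℝ≥0∞}
    (h : c < mu q {ω | crossing N a ω}) : ∃ M, c < mu q {ω | truncCrossing N M a ω} := by
  have hU : {ω | crossing N a ω} ⊆ ⋃ M, {ω | truncCrossing N M a ω} := by
    rintro ω ⟨b, hb⟩
    obtain ⟨M, hM⟩ := exists_reach_truncStrip hb
    exact Set.mem_iUnion.2 ⟨M, b, hM⟩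
  have hmono : Monotone fun M => {ω | truncCrossing N M a ω} :=
    fun _ _ hM _ hω => truncCrossing_mono hM hω
  have h2 := h.trans_le (measure_mono hU)
  rw [hmono.measure_iUnion, lt_iSup_iff] at h2
  exact h2

/-! ### One quarter turn of the dual path -/

lemma hPos_vertical {ω : Config} {x y : ℤ} : hPos ω ((x, y), true) ↔
    ω ((x, y), true) = decide (0 ≤ y) := by
  have : normSq (eSrc ((x, y), true)) < normSq (eDst ((x, y), true)) ↔ 0 ≤ y := by
    simp only [normSq, eSrc, eDst, if_true]
    constructor <;> intro h <;> nlinarith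
  rw [hPos, decide_eq_decide.2 this]

lemma hPos_horizontal {ω : Config} {x y : ℤ} : hPos ω ((x, y), false) ↔
    ω ((x, y), false) = decide (0 ≤ x) := by
  have : normSq (eSrc ((x, y), false)) < normSq (eDst ((x, y), false)) ↔ 0 ≤ x := by
    simp only [normSq, eSrc, eDst]
    constructor <;> intro h
    · simp at h
      nlinarith
    · simp
      nlinarith
  rw [hPos, decide_eq_decide.2 this]

lemma dualStep_iff {ω : Config} {d d' : ℤ × ℤ} : dualStep ω d d' ↔
    (d' = (d.1 + 1, d.2) ∧ ω ((d.1 + 1, d.2), true) = decide (0 ≤ d.2)) ∨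
    (d = (d'.1 + 1, d'.2) ∧ ω ((d'.1 + 1, d'.2), true) = !decide (0 ≤ d'.2)) ∨
    (d' = (d.1, d.2 + 1) ∧ ω ((d.1, d.2 + 1), false) = !decide (0 ≤ d.1)) ∨
    (d = (d'.1, d'.2 + 1) ∧ ω ((d'.1, d'.2 + 1), false) = decide (0 ≤ d'.1)) := by
  simp only [dualStep, hPos_vertical, hPos_horizontal, Bool.eq_not]

/-- The dual vertices of the NE quadrant in `Λ_M \ Λ_N`. -/
def quadAnnulus (N M : ℕ) : Set (ℤ × ℤ) := {d | dualNE d ∧ inBox M d ∧ ¬ inBox N d}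

lemma quadAnnulus_subset {N N' M M' : ℕ} (hN : N ≤ N') (hM : M' ≤ M) :
    quadAnnulus N' M' ⊆ quadAnnulus N M := by
  rintro d ⟨⟨h1, h2⟩, h3, h4⟩
  refine ⟨⟨h1, h2⟩, ?_, ?_⟩ <;> simp only [inBox] at * <;> omega

/-- The dual path from `(a, 0)` reaches `(0, b)` in the NE part of `Λ_M \ Λ_N`. -/
def arrives (N M a b : ℕ) (ω : Config) : Prop :=
  reach (dualStep ω) (quadAnnulus N M) ((a : ℤ), 0) (0, (b : ℤ))

/-- The dual path from `(a, 0)` reaches `(0, b)` in the NE part of `Λ_M \ Λ_N`, and then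
steps into the NW quadrant. -/
def quarterTurn (N M a b : ℕ) (ω : Config) : Prop :=
  arrives N M a b ω ∧ ω ((0, (b : ℤ)), true) = false

/-- The edges crossed by dual edges inside the NE quadrant. -/
def innerEdges : Set Edge :=
  {e | (e.2 = true ∧ 1 ≤ e.1.1 ∧ 0 ≤ e.1.2) ∨ (e.2 = false ∧ 0 ≤ e.1.1 ∧ 1 ≤ e.1.2)}

/-- The edges crossed by dual edges between the NE and the NW quadrant. -/
def axisEdges : Set Edge := {e | e.2 = true ∧ e.1.1 = 0 ∧ 0 ≤ e.1.2}

lemma disjoint_innerEdges_axisEdges : Disjoint innerEdges axisEdges := by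
  rw [Set.disjoint_left]
  rintro e (⟨h1, h2, h3⟩ | ⟨h1, h2, h3⟩) ⟨h4, h5, h6⟩
  · omega
  · simp [h1] at h4

lemma measurableSet_dualStep {u v : ℤ × ℤ} (hu : dualNE u) (hv : dualNE v) :
    MeasurableSet[edgeAlg innerEdges] {ω | dualStep ω u v} := by
  simp only [dualStep_iff]
  obtain ⟨hu1, hu2⟩ := hu
  obtain ⟨hv1, hv2⟩ := hv
  refine (measurableSet_and_edge (fun h => ?_) _).union
    ((measurableSet_and_edge (fun h => ?_) _).union
      ((measurableSet_and_edge (fun h => ?_) _).union (measurableSet_and_edge (fun h => ?_) _)))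
  · exact Or.inl ⟨rfl, by simp only; omega, hu2⟩
  · exact Or.inl ⟨rfl, by simp only; omega, hv2⟩
  · exact Or.inr ⟨rfl, hu1, by simp only; omega⟩
  · exact Or.inr ⟨rfl, hv1, by simp only; omega⟩

lemma measurableSet_arrives (N M a b : ℕ) :
    MeasurableSet[edgeAlg innerEdges] {ω | arrives N M a b ω} :=
  measurableSet_reach (m := edgeAlg innerEdges) (R := dualStep)
    (fun _ hx _ hy => measurableSet_dualStep hx.1 hy.1) _ _

lemma quarterTurn_bounds {N M a b : ℕ} {ω : Config} (hNa : N ≤ a) (haM : a < M)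
    (h : quarterTurn N M a b ω) : N ≤ b ∧ b < M := by
  have h1 : ((a : ℤ), (0 : ℤ)) ∈ quadAnnulus N M := by
    refine ⟨⟨by simp, le_rfl⟩, ?_, ?_⟩ <;> simp only [inBox] <;> omega
  obtain ⟨-, h2, h3⟩ := reach_mem h1 h.1
  simp only [inBox] at h2 h3
  omega

lemma quarterTurn_mono {N N' M M' a b : ℕ} (hN : N ≤ N') (hM : M' ≤ M) {ω : Config}
    (h : quarterTurn N' M' a b ω) : quarterTurn N M a b ω :=
  ⟨reach_mono (quadAnnulus_subset hN hM) h.1, h.2⟩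

/-- The reflection of the lattice which carries the random-orientation model with
parameter `1 - p` to the dual of the H-model with parameter `p` in the NE quadrant. -/
def reflectEdge (a : ℕ) (e : Edge) : Edge :=
  if e.2 then (((a : ℤ) - e.1.1, e.1.2 + 1), false) else (((a : ℤ) - e.1.1, e.1.2), true)

lemma reflectEdge_injective (a : ℕ) : Function.Injective (reflectEdge a) := by
  rintro ⟨⟨x, y⟩, b⟩ ⟨⟨x', y'⟩, b'⟩ h
  cases b <;> cases b' <;> simp_all [reflectEdge]

lemma dualStep_reflect {ω : Config} {a : ℕ} {u v : ℤ × ℤ}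
    (hu : 0 ≤ u.2 ∧ u.1 ≤ a) (hv : 0 ≤ v.2 ∧ v.1 ≤ a)
    (h : gStep (fun e => !ω (reflectEdge a e)) u v) :
    dualStep ω ((a : ℤ) - u.1, u.2) ((a : ℤ) - v.1, v.2) := by
  rw [dualStep_iff]
  rcases gStep_iff.1 h with ⟨e, hω⟩ | ⟨e, hω⟩ | ⟨e, hω⟩ | ⟨e, hω⟩
  · right; left
    simp only [e, reflectEdge] at hω ⊢
    have e1 : (a : ℤ) - (u.1 + 1) + 1 = a - u.1 := by ring
    rw [e1]
    simp_all
  · right; right; left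
    simp only [e, reflectEdge] at hω ⊢
    simp_all
  · left
    simp only [e, reflectEdge] at hω ⊢
    have e1 : (a : ℤ) - (v.1 + 1) + 1 = a - v.1 := by ring
    rw [e1]
    simp_all
  · right; right; right
    simp only [e, reflectEdge] at hω ⊢
    simp_all

lemma reach_map {R R' : ℤ × ℤ → ℤ × ℤ → Prop} {V V' : Set (ℤ × ℤ)}
    (f : ℤ × ℤ → ℤ × ℤ) (hV : ∀ u ∈ V, f u ∈ V') (hR : ∀ u ∈ V, ∀ v ∈ V, R u v → R' (f u) (f v))
    {u v : ℤ × ℤ} (h : reach R V u v) : reach R' V' (f u) (f v) := by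
  induction h with
  | refl => exact Relation.ReflTransGen.refl
  | tail _ h ih => exact ih.tail ⟨hV _ h.1, hV _ h.2.1, hR _ h.1 _ h.2.1 h.2.2⟩

lemma arrives_of_truncCrossing {ω : Config} {N M a : ℕ}
    (h : truncCrossing N M a (fun e => !ω (reflectEdge a e))) :
    ∃ b, arrives N (max M (a + 1)) a b ω := by
  obtain ⟨b, hb⟩ := h
  have hmem : ∀ u ∈ truncStrip N M a,
      ((a : ℤ) - u.1, u.2) ∈ quadAnnulus N (max M (a + 1)) := by
    rintro u ⟨⟨h1, h2, h3, h4⟩, h5⟩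
    refine ⟨⟨by simp only; omega, h3⟩, ?_, ?_⟩ <;> simp only [inBox] <;> push_cast <;> omega
  have key := reach_map (R' := dualStep ω) (fun u : ℤ × ℤ => ((a : ℤ) - u.1, u.2)) hmem
    (fun u hu v hv huv => dualStep_reflect ⟨hu.1.2.2.1, hu.1.2.1⟩ ⟨hv.1.2.2.1, hv.1.2.1⟩ huv) hb
  refine ⟨b, ?_⟩
  simpa [arrives] using key

lemma mul_le_mu_iUnion_inter {p : ℝ} (hp0 : 0 ≤ p) (hp1 : p ≤ 1) {S T : Set Edge}
    (hST : Disjoint S T) {A F : ℕ → Set Config} (hA : ∀ b, MeasurableSet[edgeAlg S] (A b))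
    (hF : ∀ b, MeasurableSet[edgeAlg T] (F b)) {c : ℝ≥0∞}
    (hc : ∀ b, (A b).Nonempty → c ≤ mu p (F b)) :
    mu p (⋃ b, A b) * c ≤ mu p (⋃ b, A b ∩ F b) := by
  have hD : ∀ b, MeasurableSet[edgeAlg S] (disjointed A b) := fun b =>
    @MeasurableSet.disjointed Config (edgeAlg S) A hA b
  have hDi := disjoint_disjointed A
  calc mu p (⋃ b, A b) * c = ∑' b, mu p (disjointed A b) * c := by
        rw [← iUnion_disjointed, measure_iUnion hDi fun b => edgeAlg_le _ _ (hD b),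
          ENNReal.tsum_mul_right]
    _ ≤ ∑' b, mu p (disjointed A b ∩ F b) := by
        refine ENNReal.tsum_le_tsum fun b => ?_
        rw [mu_inter hp0 hp1 hST (hD b) (hF b)]
        rcases (disjointed A b).eq_empty_or_nonempty with h | h
        · simp [h]
        · gcongr
          exact hc b (h.mono (disjointed_subset A b))
    _ = mu p (⋃ b, disjointed A b ∩ F b) := by
        rw [measure_iUnion]
        · exact fun i j hij => (hDi hij).mono Set.inter_subset_left Set.inter_subset_left
        · exact fun b => (edgeAlg_le _ _ (hD b)).inter (edgeAlg_le _ _ (hF b))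
    _ ≤ mu p (⋃ b, A b ∩ F b) :=
        measure_mono (Set.iUnion_mono fun b =>
          Set.inter_subset_inter_left _ (disjointed_subset A b))

lemma exists_lt_mu_quarterTurn {p : ℝ} (hp0 : 0 ≤ p) (hp1 : p ≤ 1)
    (hθ : 0 < thetaNE (1 - p)) {N : ℕ} (hN : 0 < N) :
    ∃ A, N ≤ A ∧ ∀ a ≥ A, ∃ M, a < M ∧
      thetaNE (1 - p) * ENNReal.ofReal (1 - p) / 2 < mu p (⋃ b, {ω | quarterTurn N M a b ω}) := by
  have hq0 : 0 ≤ 1 - p := by linarith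
  have hq1 : 1 - p ≤ 1 := by linarith
  have hq := pos_of_thetaNE_pos hq0 hq1 hθ
  obtain ⟨A, hNA, hA⟩ := exists_forall_lt_mu_crossing hq0 hq1 hθ hN
  refine ⟨A, hNA, fun a ha => ?_⟩
  obtain ⟨M, hM⟩ := exists_lt_mu_truncCrossing (hA a ha)
  refine ⟨max M (a + 1), by omega, ?_⟩
  have h1 : thetaNE (1 - p) / 2 < mu p (⋃ b, {ω | arrives N (max M (a + 1)) a b ω}) := by
    rw [← mu_preimage_not_comp hp0 hp1 (reflectEdge_injective a)
      (measurableSet_truncCrossing N M a)] at hM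
    refine hM.trans_le (measure_mono fun ω hω => ?_)
    obtain ⟨b, hb⟩ := arrives_of_truncCrossing hω
    exact Set.mem_iUnion.2 ⟨b, hb⟩
  have h2 := mul_le_mu_iUnion_inter hp0 hp1 disjoint_innerEdges_axisEdges
    (A := fun b => {ω | arrives N (max M (a + 1)) a b ω})
    (F := fun b => {ω | ω ((0, (b : ℤ)), true) = false}) (c := ENNReal.ofReal (1 - p))
    (fun b => measurableSet_arrives _ _ _ _)
    (fun b => measurableSet_edge (S := axisEdges) ⟨rfl, rfl, by simp⟩ _)
    (fun b _ => (mu_edge_false hp0 hp1 _).ge)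
  refine lt_of_lt_of_le ?_ h2
  rw [ENNReal.mul_div_right_comm]
  exact ENNReal.mul_lt_mul_left (by simpa using hq) ENNReal.ofReal_ne_top h1

/-! ### Rotations -/

/-- The rotation by `π/2` of the dual lattice. -/
def rotD (d : ℤ × ℤ) : ℤ × ℤ := (-d.2 - 1, d.1)

/-- The rotation by `π/2` of the edges of the primal lattice. -/
def rotE (e : Edge) : Edge :=
  if e.2 then ((-e.1.2 - 1, e.1.1), false) else ((-e.1.2, e.1.1), true)

/-- The configuration `ω` seen after rotating the lattice by `π/2`. -/
def rotC (ω : Config) : Config := fun e => ω (rotE e)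

lemma rotE_injective : Function.Injective rotE := by
  rintro ⟨⟨x, y⟩, b⟩ ⟨⟨x', y'⟩, b'⟩ h
  cases b <;> cases b' <;> simp_all [rotE]

lemma inBox_rotD {m : ℕ} {d : ℤ × ℤ} : inBox m (rotD d) ↔ inBox m d := by
  simp only [inBox, rotD]
  omega

lemma inBox_iterate_rotD {m : ℕ} (k : ℕ) {d : ℤ × ℤ} : inBox m (rotD^[k] d) ↔ inBox m d := by
  induction k with
  | zero => rfl
  | succ k ih => rw [Function.iterate_succ_apply', inBox_rotD, ih]

lemma dualStep_rotD {ω : Config} {d d' : ℤ × ℤ} (h : dualStep (rotC ω) d d') :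
    dualStep ω (rotD d) (rotD d') := by
  obtain ⟨x, y⟩ := d
  obtain ⟨x', y'⟩ := d'
  rw [dualStep_iff] at h ⊢
  simp only [rotC, rotE, rotD, Prod.mk.injEq, if_true, Bool.false_eq_true, if_false] at h ⊢
  rcases h with ⟨⟨rfl, rfl⟩, h⟩ | ⟨⟨rfl, rfl⟩, h⟩ | ⟨⟨rfl, rfl⟩, h⟩ | ⟨⟨rfl, rfl⟩, h⟩
  · right; right; left
    refine ⟨⟨rfl, rfl⟩, h.trans ?_⟩
    change decide (0 ≤ y') = !decide (0 ≤ -y' - 1)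
    rw [← decide_not, decide_eq_decide]
    omega
  · right; right; right
    refine ⟨⟨rfl, rfl⟩, h.trans ?_⟩
    change (!decide (0 ≤ y)) = decide (0 ≤ -y - 1)
    rw [← decide_not, decide_eq_decide]
    omega
  · right; left
    have e : -(y + 1) - 1 + 1 = -(y + 1) := by ring
    refine ⟨⟨by ring, rfl⟩, ?_⟩
    rw [e]
    exact h
  · left
    have e : -(y' + 1) - 1 + 1 = -(y' + 1) := by ring
    refine ⟨⟨by ring, rfl⟩, ?_⟩
    rw [e]
    exact h

lemma dualStep_iterate_rotD (k : ℕ) {ω : Config} {d d' : ℤ × ℤ}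
    (h : dualStep (rotC^[k] ω) d d') : dualStep ω (rotD^[k] d) (rotD^[k] d') := by
  induction k generalizing ω with
  | zero => exact h
  | succ k ih =>
    rw [Function.iterate_succ_apply', Function.iterate_succ_apply']
    exact dualStep_rotD (ih h)

/-! ### Chains of quarter turns -/

/-- `k` successive quarter turns, started from `(a, 0)`. -/
def chain (N M : ℕ) : ℕ → ℕ → Config → Prop
  | 0, _, _ => True
  | k + 1, a, ω => ∃ b, quarterTurn N M a b ω ∧ chain N M k b (rotC ω)

lemma chain_mono {N M M' : ℕ} (hM : M' ≤ M) {k a : ℕ} {ω : Config} (h : chain N M' k a ω) :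
    chain N M k a ω := by
  induction k generalizing a ω with
  | zero => trivial
  | succ k ih =>
    obtain ⟨b, hb, h⟩ := h
    exact ⟨b, quarterTurn_mono le_rfl hM hb, ih h⟩

lemma exists_seq_of_chain {N M k a : ℕ} {ω : Config} (h : chain N M k a ω) :
    ∃ c : ℕ → ℕ, c 0 = a ∧ ∀ i < k, quarterTurn N M (c i) (c (i + 1)) (rotC^[i] ω) := by
  induction k generalizing a ω with
  | zero => exact ⟨fun _ => a, rfl, by simp⟩
  | succ k ih =>
    obtain ⟨b, hb, h⟩ := h
    obtain ⟨c, rfl, hc⟩ := ih h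
    refine ⟨fun i => Nat.casesOn i a c, rfl, fun i hi => ?_⟩
    cases i with
    | zero => exact hb
    | succ i => exact hc i (by omega)

/-- The number of rotations which carry the edges that decide the first quarter turn
to the sector of `e`. -/
def sector (e : Edge) : ℕ :=
  if e.2 then
    if 0 ≤ e.1.1 ∧ 0 ≤ e.1.2 then 0 else if e.1.1 < 0 ∧ 0 ≤ e.1.2 then 1
    else if e.1.1 ≤ 0 then 2 else 3
  else
    if 0 ≤ e.1.1 ∧ 1 ≤ e.1.2 then 0 else if e.1.1 < 0 ∧ 0 ≤ e.1.2 then 1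
    else if e.1.1 < 0 then 2 else 3

lemma sector_rotE {e : Edge} (h : sector e < 3) : sector (rotE e) = sector e + 1 := by
  obtain ⟨⟨x, y⟩, b⟩ := e
  cases b <;> simp only [sector, rotE, if_true, Bool.false_eq_true, if_false] at h ⊢ <;> grind

lemma measurableSet_rotC {S T : Set Edge} (hST : ∀ e ∈ S, rotE e ∈ T) {A : Set Config}
    (hA : MeasurableSet[edgeAlg S] A) : MeasurableSet[edgeAlg T] {ω | rotC ω ∈ A} := by
  have h : edgeAlg S ≤ MeasurableSpace.map rotC (edgeAlg T) := by
    refine iSup₂_le fun e he => ?_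
    rintro _ ⟨B, -, rfl⟩
    exact le_iSup₂ (f := fun (e : Edge) (_ : e ∈ T) =>
      MeasurableSpace.comap (fun ω : Config => ω e) ⊤) (rotE e) (hST e he) _ ⟨B, trivial, rfl⟩
  exact h A hA

lemma measurableSet_quarterTurn (N M a b : ℕ) :
    MeasurableSet[edgeAlg {e | sector e = 0}] {ω | quarterTurn N M a b ω} := by
  refine MeasurableSet.inter (edgeAlg_mono ?_ _ (measurableSet_arrives N M a b))
    (measurableSet_edge ?_ _)
  · rintro ⟨⟨x, y⟩, d⟩ h
    simp only [innerEdges, sector, Set.mem_ofPred_eq] at h ⊢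
    grind
  · simp [sector]

lemma measurableSet_chain (N M : ℕ) {k : ℕ} (hk : k ≤ 4) (a : ℕ) :
    MeasurableSet[edgeAlg {e | sector e < k}] {ω | chain N M k a ω} := by
  induction k generalizing a with
  | zero => exact MeasurableSet.univ
  | succ k ih =>
    have : {ω | chain N M (k + 1) a ω} =
        ⋃ b, {ω | quarterTurn N M a b ω} ∩ {ω | rotC ω ∈ {ω | chain N M k b ω}} := by
      ext ω
      simp [chain]
    rw [this]
    refine MeasurableSet.iUnion fun b => MeasurableSet.inter ?_ ?_
    · refine edgeAlg_mono (fun e he => ?_) _ (measurableSet_quarterTurn N M a b)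
      simp only [Set.mem_ofPred_eq] at he ⊢
      omega
    · refine measurableSet_rotC (fun e he => ?_) (ih (by omega) b)
      simp only [Set.mem_ofPred_eq] at he ⊢
      rw [sector_rotE (by omega)]
      omega

lemma measurableSet_chain_rotC (N M : ℕ) {k : ℕ} (hk : k ≤ 3) (a : ℕ) :
    MeasurableSet[edgeAlg {e | sector e ≠ 0}] {ω | chain N M k a (rotC ω)} := by
  refine measurableSet_rotC (fun e he => ?_) (measurableSet_chain N M (by omega) a)
  simp only [Set.mem_ofPred_eq] at he ⊢
  rw [sector_rotE (by omega)]
  omega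

lemma exists_lt_mu_chain_succ {p : ℝ} (hp0 : 0 ≤ p) (hp1 : p ≤ 1)
    (hθ : 0 < thetaNE (1 - p)) {c : ℝ≥0∞} (hc0 : c ≠ 0) (hc : c ≠ ∞) {N k : ℕ} (hN : 0 < N)
    (hk : k ≤ 3)
    (ih : ∃ A, N ≤ A ∧ ∀ a ≥ A, ∃ M, a < M ∧ c ≤ mu p {ω | chain N M k a ω}) :
    ∃ A, N ≤ A ∧ ∀ a ≥ A, ∃ M, a < M ∧
      thetaNE (1 - p) * ENNReal.ofReal (1 - p) / 2 * c < mu p {ω | chain N M (k + 1) a ω} := by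
  obtain ⟨A₀, hNA₀, hA₀⟩ := ih
  obtain ⟨A, hA₀A, hA⟩ := exists_lt_mu_quarterTurn hp0 hp1 hθ (hN.trans_le hNA₀)
  refine ⟨A, hNA₀.trans hA₀A, fun a ha => ?_⟩
  obtain ⟨M₁, haM₁, hM₁⟩ := hA a ha
  choose! m hm using hA₀
  set M := max M₁ ((Finset.range M₁).sup m) with hM
  refine ⟨M, by omega, (ENNReal.mul_lt_mul_left hc0 hc hM₁).trans_le ?_⟩
  have hdisj : Disjoint {e | sector e = 0} {e | sector e ≠ 0} :=
    Set.disjoint_left.2 fun _ h h' => h' h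
  refine (mul_le_mu_iUnion_inter hp0 hp1 hdisj
    (F := fun b => {ω | chain N M k b (rotC ω)})
    (fun b => measurableSet_quarterTurn _ _ _ b)
    (fun b => measurableSet_chain_rotC _ _ hk b) ?_).trans (measure_mono ?_)
  · rintro b ⟨ω, hω⟩
    obtain ⟨h1, h2⟩ := quarterTurn_bounds (hA₀A.trans ha) haM₁ hω
    have hb : m b ≤ M := (Finset.le_sup (f := m) (Finset.mem_range.2 h2)).trans (le_max_right _ _)
    refine ((hm b h1).2.trans (measure_mono fun ω h => chain_mono hb h)).trans_eq ?_
    exact (mu_preimage_comp hp0 hp1 rotE_injective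
      (edgeAlg_le _ _ (measurableSet_chain N M (by omega) b))).symm
  · refine Set.iUnion_subset fun b ω hω => ⟨b, quarterTurn_mono hNA₀ (le_max_left _ _) hω.1, hω.2⟩

lemma exists_lt_mu_chain {p : ℝ} (hp0 : 0 ≤ p) (hp1 : p ≤ 1) (hθ : 0 < thetaNE (1 - p))
    {N : ℕ} (hN : 0 < N) {k : ℕ} (hk : k ≤ 3) :
    ∃ A, N ≤ A ∧ ∀ a ≥ A, ∃ M, a < M ∧
      (thetaNE (1 - p) * ENNReal.ofReal (1 - p) / 2) ^ (k + 1) <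
        mu p {ω | chain N M (k + 1) a ω} := by
  have hp := isProbabilityMeasure_mu hp0 hp1
  have hp' := isProbabilityMeasure_mu (p := 1 - p) (by linarith) (by linarith)
  have hq := pos_of_thetaNE_pos (by linarith) (by linarith) hθ
  have h0 : thetaNE (1 - p) * ENNReal.ofReal (1 - p) / 2 ≠ 0 := by
    refine (ENNReal.div_pos (mul_ne_zero hθ.ne' ?_) (by simp)).ne'
    simpa using hq
  have h1 : thetaNE (1 - p) * ENNReal.ofReal (1 - p) / 2 ≠ ∞ :=
    ENNReal.div_ne_top (ENNReal.mul_ne_top (measure_ne_top _ _) ENNReal.ofReal_ne_top) (by simp)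
  induction k with
  | zero =>
    have := exists_lt_mu_chain_succ hp0 hp1 hθ one_ne_zero ENNReal.one_ne_top hN (Nat.zero_le 3)
      ⟨N, le_rfl, fun a _ => ⟨a + 1, by omega, by simp [chain]⟩⟩
    simpa using this
  | succ k ih =>
    obtain ⟨A, hNA, hA⟩ := ih (by omega)
    have := exists_lt_mu_chain_succ hp0 hp1 hθ (pow_ne_zero (k + 1) h0) (ENNReal.pow_ne_top h1)
      hN hk ⟨A, hNA, fun a ha => (hA a ha).imp fun M h => ⟨h.1, h.2.le⟩⟩
    simpa only [← pow_succ'] using this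

/-! ### From chains to paths -/

lemma exists_walk_of_reach {R : ℤ × ℤ → ℤ × ℤ → Prop} {V : Set (ℤ × ℤ)} {u v : ℤ × ℤ}
    (hu : u ∈ V) (h : reach R V u v) : ∃ (n : ℕ) (w : ℕ → ℤ × ℤ), w 0 = u ∧ w n = v ∧
      (∀ i < n, R (w i) (w (i + 1))) ∧ ∀ i ≤ n, w i ∈ V := by
  induction h with
  | refl => exact ⟨0, fun _ => u, rfl, rfl, by simp, fun _ _ => hu⟩
  | @tail x y _ h ih =>
    obtain ⟨n, w, h0, hn, hR, hV⟩ := ih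
    refine ⟨n + 1, fun i => if i ≤ n then w i else y, by simpa using h0, by simp,
      fun i hi => ?_, fun i hi => ?_⟩
    · rcases Nat.lt_succ_iff_lt_or_eq.1 hi with hi | rfl
      · simpa [hi.le, Nat.succ_le_iff.2 hi] using hR i hi
      · simpa [hn] using h.2.2
    · by_cases hin : i ≤ n
      · simpa [hin] using hV i hin
      · simpa [hin] using h.2.1

/-- Concatenation of walks inside `V 0, V 1, …, V (m - 1)`. -/
lemma exists_concat {R : ℤ × ℤ → ℤ × ℤ → Prop} {V : ℕ → Set (ℤ × ℤ)} {u v : ℕ → ℤ × ℤ} (m : ℕ)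
    (hu : ∀ k < m, u k ∈ V k) (hr : ∀ k < m, reach R (V k) (u k) (v k))
    (hv : ∀ k < m, R (v k) (u (k + 1))) :
    ∃ (γ : ℕ → ℤ × ℤ) (T : ℕ → ℕ), T 0 = 0 ∧ γ 0 = u 0 ∧ γ (T m) = u m ∧
      (∀ i < T m, R (γ i) (γ (i + 1))) ∧
      ∀ k < m, T k < T (k + 1) ∧ ∀ i, T k ≤ i → i < T (k + 1) → γ i ∈ V k := by
  induction m with
  | zero => exact ⟨fun _ => u 0, fun _ => 0, rfl, rfl, rfl, by simp, by simp⟩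
  | succ m ih =>
    obtain ⟨γ, T, hT, h0, hm, hR, hV⟩ := ih (fun k hk => hu k (by omega))
      (fun k hk => hr k (by omega)) (fun k hk => hv k (by omega))
    obtain ⟨n, w, w0, wn, wR, wV⟩ :=
      exists_walk_of_reach (hu m (Nat.lt_succ_self m)) (hr m (Nat.lt_succ_self m))
    have hlast := hv m (Nat.lt_succ_self m)
    have hγ : ∀ i ≤ T m, (if i < T m then γ i else if i ≤ T m + n then w (i - T m) else u (m + 1))
        = γ i := by
      intro i hi
      rcases hi.lt_or_eq with h | rfl
      · simp [h]
      · simp [w0, hm]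
    refine ⟨fun i => if i < T m then γ i else if i ≤ T m + n then w (i - T m) else u (m + 1),
      fun k => if k ≤ m then T k else T m + n + 1, by simpa using hT, ?_, ?_, ?_, ?_⟩
    · exact (hγ 0 (Nat.zero_le _)).trans h0
    · simp [show ¬ (T m + n + 1 < T m) by omega, show ¬ (T m + n + 1 ≤ T m + n) by omega]
    · intro i hi
      simp only [show ¬ (m + 1 ≤ m) by omega, if_false] at hi
      rcases lt_or_ge i (T m) with h | h
      · simp only [hγ i h.le, hγ (i + 1) h]
        exact hR i h
      · obtain ⟨j, rfl⟩ := Nat.exists_eq_add_of_le h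
        have e : T m + j + 1 - T m = j + 1 := by omega
        simp only [show ¬ (T m + j < T m) by omega, show ¬ (T m + j + 1 < T m) by omega,
          show T m + j ≤ T m + n by omega, if_false, if_true, Nat.add_sub_cancel_left, e]
        rcases (show j < n ∨ j = n by omega) with hj | rfl
        · rw [if_pos (by omega)]
          exact wR j hj
        · rw [if_neg (by omega), wn]
          exact hlast
    · intro k hk
      rcases (show k < m ∨ k = m by omega) with h | rfl
      · simp only [h.le, show k + 1 ≤ m by omega, if_true]
        refine ⟨(hV k h).1, fun i hi hi' => ?_⟩
        have hle : T (k + 1) ≤ T m :=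
          Nat.le_induction (P := fun j _ => j ≤ m → T (k + 1) ≤ T j) (fun _ => le_rfl)
            (fun j _ ih hj => (ih (by omega)).trans (hV j (by omega)).1.le) m h le_rfl
        rw [hγ i (by omega)]
        exact (hV k h).2 i hi hi'
      · simp only [le_refl, show ¬ (k + 1 ≤ k) by omega, if_true, if_false]
        refine ⟨by omega, fun i hi hi' => ?_⟩
        rw [if_neg (by omega), if_pos (by omega)]
        exact wV _ (by omega)

lemma BOpath_of_chain {N M a : ℕ} {ω : Config} (hNa : N ≤ a) (haM : a < M)
    (h : chain N M 4 a ω) : BOpath N M a ω := by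
  obtain ⟨c, rfl, hc⟩ := exists_seq_of_chain h
  have hb : ∀ i ≤ 4, N ≤ c i ∧ c i < M := by
    intro i
    induction i with
    | zero => exact fun _ => ⟨hNa, haM⟩
    | succ i ih =>
      intro hi
      obtain ⟨h1, h2⟩ := ih (by omega)
      exact quarterTurn_bounds h1 h2 (hc i (by omega))
  have hmem : ∀ i ≤ 4, (((c i : ℕ) : ℤ), (0 : ℤ)) ∈ quadAnnulus N M := by
    intro i hi
    obtain ⟨h1, h2⟩ := hb i hi
    refine ⟨⟨by simp, le_rfl⟩, ?_, ?_⟩ <;> simp only [inBox] <;> omega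
  obtain ⟨γ, T, hT0, h0, h4, hR, hV⟩ := exists_concat (R := dualStep ω)
    (V := fun k => rotD^[k] '' quadAnnulus N M)
    (u := fun k => rotD^[k] ((c k : ℤ), 0)) (v := fun k => rotD^[k] (0, (c (k + 1) : ℤ))) 4
    (fun k hk => Set.mem_image_of_mem _ (hmem k hk.le))
    (fun k hk => reach_map _ (fun _ => Set.mem_image_of_mem _)
      (fun _ _ _ _ h => dualStep_iterate_rotD k h) (hc k hk).1)
    (fun k hk => by
      rw [Function.iterate_succ_apply]
      refine dualStep_iterate_rotD k (dualStep_iff.2 (Or.inr (Or.inl ?_)))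
      simpa [rotD] using (hc k hk).2)
  have hbox : ∀ k < 4, ∀ i, T k ≤ i → i < T (k + 1) → inBox M (γ i) ∧ ¬ inBox N (γ i) := by
    intro k hk i hi hi'
    obtain ⟨d, hd, e⟩ := (hV k hk).2 i hi hi'
    rw [← e, inBox_iterate_rotD, inBox_iterate_rotD]
    exact hd.2
  have h4' : γ (T 4) = ((c 4 : ℤ), 0) := by
    rw [h4]
    simp [rotD]
  have t0 := (hV 0 (by omega)).1
  have t1 := (hV 1 (by omega)).1
  have t2 := (hV 2 (by omega)).1
  have t3 := (hV 3 (by omega)).1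
  simp only [Nat.reduceAdd, zero_add] at t0 t1 t2 t3
  refine ⟨γ, T 4, T 1 - 1, T 2 - 1, T 3 - 1, by omega, by omega, by omega, h0, by rw [h4'],
    by simp [h4'], hR, ?_, ?_, ?_, ?_, ?_⟩
  · intro i hi
    rcases (show i < T 1 ∨ (T 1 ≤ i ∧ i < T 2) ∨ (T 2 ≤ i ∧ i < T 3) ∨ (T 3 ≤ i ∧ i < T 4) ∨
      i = T 4 by omega) with h | h | h | h | rfl
    · exact hbox 0 (by omega) i (by omega) h
    · exact hbox 1 (by omega) i h.1 h.2
    · exact hbox 2 (by omega) i h.1 h.2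
    · exact hbox 3 (by omega) i h.1 h.2
    · rw [h4']
      exact (hmem 4 le_rfl).2
  · intro i hi
    obtain ⟨d, hd, e⟩ := (hV 0 (by omega)).2 i (by omega) (by simp only [zero_add]; omega)
    rw [← e]
    exact hd.1
  · intro i hi hi'
    obtain ⟨d, ⟨⟨hd1, hd2⟩, -⟩, e⟩ := (hV 1 (by omega)).2 i (by omega)
      (by simp only [Nat.reduceAdd]; omega)
    rw [← e]
    simp only [dualNW, Function.iterate_succ, Function.iterate_zero, Function.comp, id, rotD]
    omega
  · intro i hi hi'
    obtain ⟨d, ⟨⟨hd1, hd2⟩, -⟩, e⟩ := (hV 2 (by omega)).2 i (by omega)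
      (by simp only [Nat.reduceAdd]; omega)
    rw [← e]
    simp only [dualSW, Function.iterate_succ, Function.iterate_zero, Function.comp, id, rotD]
    omega
  · intro i hi hi'
    obtain ⟨d, ⟨⟨hd1, hd2⟩, -⟩, e⟩ := (hV 3 (by omega)).2 i (by omega) hi'
    rw [← e]
    simp only [dualSE, Function.iterate_succ, Function.iterate_zero, Function.comp, id, rotD]
    omega

/-- If `θ = θ_NE(1-p) > 0`, then for each `N > 0` there is `M > N` such that for
some `A ∈ [N, M]` the probability that `B^O(A)` occurs with the whole path inside
`Λ_M \ Λ_N` is strictly greater than `(θ(1-p)/2)⁴`. -/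
theorem exists_BOpath_prob_gt (p : ℝ) (hp0 : 0 ≤ p) (hp1 : p ≤ 1)
    (hθ : 0 < thetaNE (1 - p)) (N : ℕ) (hN : 0 < N) :
    ∃ M a : ℕ, N < M ∧ N ≤ a ∧ a ≤ M ∧
      (thetaNE (1 - p) * ENNReal.ofReal (1 - p) / 2) ^ 4 <
        mu p {ω | BOpath N M a ω} := by
  obtain ⟨A, hNA, hA⟩ := exists_lt_mu_chain hp0 hp1 hθ hN (le_refl 3)
  obtain ⟨M, hAM, hM⟩ := hA A le_rfl
  exact ⟨M, A, hNA.trans_lt hAM, hNA, hAM.le,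
    hM.trans_le (measure_mono fun _ h => BOpath_of_chain hNA hAM h)⟩

end RandomOrientation
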